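/- Let Λ be a non-semisimple finite dimensional algebra that admits a d-cluster-tilting module and has finite global dimension at most d. Then the global dimension of Λ is exactly d. -/

import Mathlib

open CategoryTheory CategoryTheory.Limits

noncomputable section

variable {Λ : Type*} [Ring Λ]

/-- `X` belongs to `add M`: it is a direct summand of a finite direct sum of copies of `M`. -/
def MemAdd (M X : ModuleCat Λ) : Prop :=
  ∃ (n : ℕ) (s : X ⟶ ⨁ fun _ : Fin n => M) (r : (⨁ fun _ : Fin n => M) ⟶ X), s ≫ r = 𝟙 X

/-- Vanishing of `Ext^i(X, Y)`. -/
def ExtVanish (i : ℕ) (X Y : ModuleCat Λ) : Prop :=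
  Subsingleton (((Ext ℤ (ModuleCat Λ) i).obj (Opposite.op X)).obj Y)

/-- `M` is a `d`-cluster-tilting `Λ`-module: `M` is finite dimensional and, among finite
dimensional modules, `add M` coincides both with the left and with the right
`Ext^{1,…,d-1}`-orthogonal of `M`. -/
def IsClusterTilting (d : ℕ) (M : ModuleCat Λ) : Prop :=
  Module.Finite Λ M ∧
  (∀ X : ModuleCat Λ, Module.Finite Λ X →
    (MemAdd M X ↔ ∀ i, 1 ≤ i → i ≤ d - 1 → ExtVanish i X M)) ∧
  (∀ Y : ModuleCat Λ, Module.Finite Λ Y →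
    (MemAdd M Y ↔ ∀ i, 1 ≤ i → i ≤ d - 1 → ExtVanish i M Y))

universe u v w

lemma extVanish_iff {Λ : Type u} [Ring Λ] (n : ℕ) (X Y : ModuleCat.{max u w} Λ) :
    ExtVanish.{u, w} (n + 1) X Y ↔ Subsingleton (Abelian.Ext.{max u w} X Y (n + 1)) := by
  let P : ProjectiveResolution X := projectiveResolution X
  have h1 : ExtVanish.{u, w} (n + 1) X Y ↔
      ∀ f : P.complex.X (n + 1) ⟶ Y, P.complex.d (n + 2) (n + 1) ≫ f = 0 →
        ∃ g : P.complex.X n ⟶ Y, P.complex.d (n + 1) n ≫ g = f := by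
    unfold ExtVanish
    rw [← ModuleCat.isZero_iff_subsingleton, (P.isoExt (R := ℤ) (n + 1) Y).isZero_iff,
      ← HomologicalComplex.exactAt_iff_isZero_homology,
      HomologicalComplex.exactAt_iff' _ n (n + 1) (n + 2) (by simp) (by simp),
      ShortComplex.moduleCat_exact_iff]
    rfl
  rw [h1]
  constructor
  · intro h
    refine subsingleton_of_forall_eq 0 fun α => ?_
    obtain ⟨f, hf, rfl⟩ := P.extMk_surjective α (n + 2) rfl
    exact (P.extMk_eq_zero_iff f (n + 2) rfl hf n rfl).2 (h f hf)
  · intro h f hf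
    exact (P.extMk_eq_zero_iff f (n + 2) rfl hf n rfl).1 (Subsingleton.elim _ _)

lemma ext_iso_subsingleton {C : Type*} [Category C] [Abelian C] [HasExt.{w} C]
    {X X' Y Y' : C} (n : ℕ) (s : X ⟶ X') (r : X' ⟶ X) (h : s ≫ r = 𝟙 X)
    (s' : Y ⟶ Y') (r' : Y' ⟶ Y) (h' : s' ≫ r' = 𝟙 Y)
    [Subsingleton (Abelian.Ext.{w} X' Y' n)] : Subsingleton (Abelian.Ext.{w} X Y n) := by
  refine subsingleton_of_forall_eq 0 fun α => ?_
  have e1 : α = (Abelian.Ext.mk₀ s).comp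
      (((Abelian.Ext.mk₀ r).comp (α.comp (Abelian.Ext.mk₀ s') (add_zero n)) (zero_add n)).comp
        (Abelian.Ext.mk₀ r') (add_zero n)) (zero_add n) := by
    simp [h, h']
  rw [e1, Subsingleton.elim ((Abelian.Ext.mk₀ r).comp (α.comp (Abelian.Ext.mk₀ s') (add_zero n)) (zero_add n)) 0]
  simp

lemma ulift_ext {Λ : Type u} [Ring Λ] (n : ℕ)
    (h : ∀ X Y : ModuleCat.{max u v} Λ, Subsingleton (Abelian.Ext.{max u v} X Y n))
    (X Y : ModuleCat.{max u w} Λ) (hX : Module.Finite Λ X) (hY : Module.Finite Λ Y) :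
    Subsingleton (Abelian.Ext.{max u w} X Y n) := by
  have h0 : ∀ X Y : ModuleCat.{u} Λ, Subsingleton (Abelian.Ext.{u} X Y n) := fun X Y =>
    have := h ((ModuleCat.uliftFunctor.{v, u} Λ).obj X) ((ModuleCat.uliftFunctor.{v, u} Λ).obj Y)
    ((ModuleCat.uliftFunctor.{v, u} Λ).mapExt_bijective_of_preservesProjectiveObjects
      X Y n).1.subsingleton
  have small : ∀ X : ModuleCat.{max u w} Λ, Module.Finite Λ X → Small.{u} X := by
    intro X hX
    obtain ⟨m, f, hf⟩ := Module.Finite.exists_fin' Λ X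
    exact small_of_surjective hf
  have e : ∀ X : ModuleCat.{max u w} Λ, Module.Finite Λ X →
      ∃ X' : ModuleCat.{u} Λ, Nonempty (X ≅ (ModuleCat.uliftFunctor.{w, u} Λ).obj X') := by
    intro X hX
    have := small X hX
    exact ⟨ModuleCat.of Λ (Shrink.{u} X),
      ⟨((Shrink.linearEquiv Λ X).symm.trans ULift.moduleEquiv.symm).toModuleIso⟩⟩
  obtain ⟨X', ⟨eX⟩⟩ := e X hX
  obtain ⟨Y', ⟨eY⟩⟩ := e Y hY
  have := h0 X' Y'
  have := ((ModuleCat.uliftFunctor.{w, u} Λ).mapExt_bijective_of_preservesProjectiveObjects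
      X' Y' n).2.subsingleton
  exact ext_iso_subsingleton n eX.hom eX.inv (by simp) eY.hom eY.inv (by simp)

lemma exists_injective (k : Type v) [Field k] {Λ : Type u} [Ring Λ] [Algebra k Λ]
    [FiniteDimensional k Λ] (X : ModuleCat.{max u w} Λ) (hX : Module.Finite Λ X) :
    ∃ (I : ModuleCat.{max u w} Λ) (f : X ⟶ I), Module.Finite Λ I ∧ Injective I ∧ Mono f := by
  let F := ModuleCat.restrictScalars.{max u w} (algebraMap k Λ)
  let G := ModuleCat.coextendScalars.{v, u, max u w} (algebraMap k Λ)
  have hI : Module.Finite k (F.obj X) := by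
    let : Module k X := Module.compHom X (algebraMap k Λ)
    have : IsScalarTower k Λ X := IsScalarTower.of_algebraMap_smul fun _ _ => rfl
    exact (Module.Finite.trans Λ X : Module.Finite k X)
  refine ⟨G.obj (F.obj X), (ModuleCat.restrictCoextendScalarsAdj (algebraMap k Λ)).unit.app X,
    ?_, ?_, ?_⟩
  · have hL : Module.Finite k ((ModuleCat.restrictScalars (algebraMap k Λ)).obj
        (ModuleCat.of Λ Λ)) := by
      let e : Λ →ₗ[k] ((ModuleCat.restrictScalars (algebraMap k Λ)).obj (ModuleCat.of Λ Λ)) :=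
        { toFun := fun x => x
          map_add' := fun _ _ => rfl
          map_smul' := fun c x => Algebra.smul_def c x }
      exact Module.Finite.of_surjective e fun x => ⟨x, rfl⟩
    have hH : Module.Finite k ((ModuleCat.restrictScalars (algebraMap k Λ)).obj
        (ModuleCat.of Λ Λ) →ₗ[k] F.obj X) := inferInstance
    have : IsScalarTower k Λ ((ModuleCat.restrictScalars (algebraMap k Λ)).obj
        (ModuleCat.of Λ Λ) →ₗ[k] F.obj X) := by
      refine IsScalarTower.of_algebraMap_smul fun c g => LinearMap.ext fun x => ?_
      change g ((show Λ from x) * algebraMap k Λ c : Λ) = c • g x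
      rw [← g.map_smul, ← Algebra.commutes c (show Λ from x)]
      rfl
    have : Module.Finite Λ ((ModuleCat.restrictScalars (algebraMap k Λ)).obj
        (ModuleCat.of Λ Λ) →ₗ[k] F.obj X) := Module.Finite.of_restrictScalars_finite k Λ _
    exact Module.Finite.equiv (ModuleCat.CoextendScalars.equiv (algebraMap k Λ) (F.obj X)).symm
  · have : Injective (F.obj X) := by
      have := Module.injective_of_isSemisimpleRing k (F.obj X)
      exact Module.injective_object_of_injective_module k (F.obj X)
    exact Injective.injective_of_adjoint (ModuleCat.restrictCoextendScalarsAdj (algebraMap k Λ)) _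
  · rw [ModuleCat.mono_iff_injective]
    intro x y h
    have := congrArg (fun g => (ModuleCat.CoextendScalars.equiv (algebraMap k Λ) (F.obj X) g) (1 : Λ)) h
    change (1:Λ) • x = (1:Λ) • y at this
    simpa using this


lemma exists_projective {Λ : Type u} [Ring Λ]
    (X : ModuleCat.{max u w} Λ) (hX : Module.Finite Λ X) :
    ∃ (P : ModuleCat.{max u w} Λ) (f : P ⟶ X), Module.Finite Λ P ∧ Projective P ∧ Epi f := by
  obtain ⟨m, f, hf⟩ := Module.Finite.exists_fin' Λ X
  refine ⟨ModuleCat.of Λ (ULift.{w} (Fin m → Λ)),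
    ModuleCat.ofHom (f ∘ₗ ULift.moduleEquiv.toLinearMap), ?_, ?_, ?_⟩
  · exact Module.Finite.equiv (ULift.moduleEquiv (R := Λ)).symm
  · have : Module.Projective Λ (ULift.{w} (Fin m → Λ)) :=
      Module.Projective.of_equiv (ULift.moduleEquiv (R := Λ)).symm
    exact (IsProjective.iff_projective _).1 this
  · rw [ModuleCat.epi_iff_surjective]
    exact hf.comp (ULift.moduleEquiv (R := Λ)).surjective

lemma step (k : Type v) [Field k] {Λ : Type u} [Ring Λ] [Algebra k Λ]
    [FiniteDimensional k Λ] (d : ℕ) (M : ModuleCat.{max u w} Λ) (hM : IsClusterTilting.{u, w} d M)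
    (n : ℕ) (hn : n + 1 ≤ d - 1)
    (h : ∀ X Y : ModuleCat.{max u w} Λ, Module.Finite Λ X → Module.Finite Λ Y →
      Subsingleton (Abelian.Ext.{max u w} X Y (n + 2)))
    (X Y : ModuleCat.{max u w} Λ) (hX : Module.Finite Λ X) (hY : Module.Finite Λ Y) :
    Subsingleton (Abelian.Ext.{max u w} X Y (n + 1)) := by
  have : IsNoetherianRing Λ := isNoetherian_of_tower k inferInstance
  obtain ⟨-, hA, hB⟩ := hM
  obtain ⟨P, p, hP, _, _⟩ := exists_projective.{u, w} Y hY
  obtain ⟨I, j, hI, _, _⟩ := exists_injective.{u, v, w} k X hX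
  have hPM : MemAdd M P := (hA P hP).2 fun i hi _ => by
    obtain ⟨i, rfl⟩ := Nat.exists_eq_add_of_le' hi
    rw [extVanish_iff.{u, w}]
    exact Abelian.Ext.subsingleton_of_projective P M i
  have hIM : MemAdd M I := (hB I hI).2 fun i hi _ => by
    obtain ⟨i, rfl⟩ := Nat.exists_eq_add_of_le' hi
    rw [extVanish_iff.{u, w}]
    exact Abelian.Ext.subsingleton_of_injective M I i
  have hMP : Subsingleton (Abelian.Ext.{max u w} M P (n + 1)) :=
    (extVanish_iff.{u, w} n M P).1 ((hB P hP).1 hPM _ (by omega) hn)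
  have hIP : Subsingleton (Abelian.Ext.{max u w} I P (n + 1)) := by
    obtain ⟨m, s, r, hsr⟩ := hIM
    have := (Abelian.Ext.biproductAddEquiv
      (biproduct.isBilimit (fun _ : Fin m => M)) P (n + 1)).injective.subsingleton
    exact ext_iso_subsingleton (n + 1) s r hsr (𝟙 P) (𝟙 P) (by simp)
      (X' := (biproduct.bicone (fun _ : Fin m => M)).pt)
  have hIY : Subsingleton (Abelian.Ext.{max u w} I Y (n + 1)) := by
    have hS : (ShortComplex.mk (kernel.ι p) p (kernel.condition p)).ShortExact :=
      { exact := ShortComplex.exact_of_f_is_kernel _ (kernelIsKernel p) }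
    have hK : Module.Finite Λ (kernel p : ModuleCat.{max u w} Λ) :=
      Module.Finite.of_injective (kernel.ι p).hom ((ModuleCat.mono_iff_injective _).1 inferInstance)
    have := h I _ hI hK
    refine subsingleton_of_forall_eq 0 fun α => ?_
    obtain ⟨β, rfl⟩ := Abelian.Ext.covariant_sequence_exact₃ _ hS α rfl (Subsingleton.elim _ _)
    rw [Subsingleton.elim (α := Abelian.Ext.{max u w} I P (n + 1)) β 0]
    simp
  have hS : (ShortComplex.mk j (cokernel.π j) (cokernel.condition j)).ShortExact :=
    { exact := ShortComplex.exact_of_g_is_cokernel _ (cokernelIsCokernel j) }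
  have hK : Module.Finite Λ (cokernel j : ModuleCat.{max u w} Λ) :=
    Module.Finite.of_surjective (cokernel.π j).hom
      ((ModuleCat.epi_iff_surjective _).1 inferInstance)
  have := h _ Y hK hY
  refine subsingleton_of_forall_eq 0 fun α => ?_
  obtain ⟨β, rfl⟩ := Abelian.Ext.contravariant_sequence_exact₁ hS _ α (n₁ := n + 2) (by omega)
    (Subsingleton.elim _ _)
  rw [Subsingleton.elim (α := Abelian.Ext.{max u w} I Y (n + 1)) β 0]
  simp

lemma semisimple_of_ext_one {Λ : Type u} [Ring Λ] [IsNoetherianRing Λ]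
    (h : ∀ X Y : ModuleCat.{max u w} Λ, Module.Finite Λ X → Module.Finite Λ Y →
      Subsingleton (Abelian.Ext.{max u w} X Y 1)) : IsSemisimpleRing Λ := by
  have key : ComplementedLattice (Submodule Λ (ULift.{w} Λ)) := by
    refine ⟨fun N => ?_⟩
    let S : ShortComplex (ModuleCat.{max u w} Λ) :=
      ShortComplex.mk (ModuleCat.ofHom N.subtype) (ModuleCat.ofHom N.mkQ) (by ext; simp)
    have : Mono S.f := (ModuleCat.mono_iff_injective _).2 N.subtype_injective
    have : Epi S.g := (ModuleCat.epi_iff_surjective _).2 N.mkQ_surjective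
    have hS : S.ShortExact :=
      { exact := by
          rw [ShortComplex.ShortExact.moduleCat_exact_iff_function_exact]
          exact LinearMap.exact_subtype_mkQ N }
    have hU : Module.Finite Λ (ULift.{w} Λ) := Module.Finite.equiv (ULift.moduleEquiv (R := Λ)).symm
    have hN : Module.Finite Λ N := inferInstance
    have := h S.X₃ S.X₁ (inferInstanceAs (Module.Finite Λ (ULift.{w} Λ ⧸ N))) hN
    obtain ⟨x, hx⟩ := Abelian.Ext.contravariant_sequence_exact₁ hS S.X₁
      (Abelian.Ext.mk₀ (𝟙 S.X₁)) (n₁ := 1) rfl (Subsingleton.elim _ _)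
    obtain ⟨r, rfl⟩ := (Abelian.Ext.mk₀_bijective _ _).2 x
    rw [Abelian.Ext.mk₀_comp_mk₀] at hx
    have hr := (Abelian.Ext.mk₀_bijective _ _).1 hx
    refine ⟨LinearMap.ker r.hom, LinearMap.isCompl_of_proj (f := r.hom) fun y => ?_⟩
    exact congrArg (fun g => g.hom y) hr
  have : IsSemisimpleModule Λ (ULift.{w} Λ) := { toComplementedLattice := key }
  exact IsSemisimpleModule.congr (ULift.moduleEquiv (R := Λ)).symm

lemma descend (k : Type v) [Field k] {Λ : Type u} [Ring Λ] [Algebra k Λ]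
    [FiniteDimensional k Λ] (d : ℕ) (M : ModuleCat.{max u w} Λ) (hM : IsClusterTilting.{u, w} d M)
    (n : ℕ) (hn : n + 1 ≤ d)
    (h : ∀ X Y : ModuleCat.{max u w} Λ, Module.Finite Λ X → Module.Finite Λ Y →
      Subsingleton (Abelian.Ext.{max u w} X Y (n + 1))) : IsSemisimpleRing Λ := by
  have : IsNoetherianRing Λ := isNoetherian_of_tower k inferInstance
  induction n with
  | zero => exact semisimple_of_ext_one.{u, w} h
  | succ n ih => exact ih (by omega) (step.{u, v, w} k d M hM n (by omega) h)

/-- A non-semisimple weakly `d`-representation-finite algebra of global dimension at most `d`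
has global dimension exactly `d`: some `Ext^d` group is non-zero. -/
theorem gldim_eq_d_of_cluster_tilting
    (k : Type*) [Field k] {Λ : Type*} [Ring Λ] [Algebra k Λ] [FiniteDimensional k Λ]
    (hss : ¬ IsSemisimpleRing Λ)
    (d : ℕ) (hd : 1 ≤ d) (M : ModuleCat Λ) (hM : IsClusterTilting d M)
    (hgl : ∀ (X Y : ModuleCat Λ) (i : ℕ), d < i → ExtVanish i X Y) :
    ∃ X Y : ModuleCat Λ, ¬ ExtVanish d X Y := by
  by_contra hcon
  push Not at hcon
  obtain ⟨n, rfl⟩ := Nat.exists_eq_add_of_le' hd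
  exact hss (descend k (n + 1) M hM n le_rfl
    (ulift_ext (n + 1) fun X Y => (extVanish_iff n X Y).1 (hcon X Y)))

end
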